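/- In the bipartite random clustering setup, with probability at least 99/100 the following holds: for every T ⊆ V(G) with |T ∩ V_j| ≤ 1 for each j ∈ [2], there are at least (1 − 1/C)·m' indices i ∈ [2, m'] for which δ_{1}(G[D_i ∪ T]) + δ_{2}(G[D_i ∪ T]) ≥ (1 + ε/2)·C. -/

import Mathlib

/-- Index of the interval containing `x` (1-based): `W_1 = [0, r)`, and for `i ≥ 2`,
`W_i` is the `(i-1)`-st interval of length `w` after that. -/
def clusterIndex (r w x : ℕ) : ℕ := if x < r then 1 else (x - r) / w + 2

open Classical in
/-- Uniform probability, over a pair of independent uniformly random permutations,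
of the event `E`. -/
noncomputable def permProb (N M : ℕ)
    (E : Equiv.Perm (Fin N) × Equiv.Perm (Fin M) → Prop) : ℝ :=
  (((Finset.univ : Finset (Equiv.Perm (Fin N) × Equiv.Perm (Fin M))).filter E).card : ℝ) /
    ((Finset.univ : Finset (Equiv.Perm (Fin N) × Equiv.Perm (Fin M))).card : ℝ)

/-- One side of the `i`-th random cluster `D_i`: the set of `j` with `π j` in the `i`-th
interval, where the first interval has length `r = (C-1)C + (n mod (C-1)C)` and the later
ones length `C-1`. -/
def bipCluster (n C i : ℕ) (π : Equiv.Perm (Fin n)) : Finset (Fin n) :=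
  Finset.univ.filter fun v =>
    clusterIndex ((C - 1) * C + n % ((C - 1) * C)) (C - 1) (π v).val = i

/-- The number `m'` of clusters. -/
def numClustersBip (n C : ℕ) : ℕ :=
  (n - ((C - 1) * C + n % ((C - 1) * C))) / (C - 1) + 1

open Finset in
/-- Negative correlation for random permutations: all points of `A` have their preimage in `M` with
probability at most `(#M / n) ^ #A`. -/
theorem card_perm_forall_symm_mem_le {α : Type*} [Fintype α] [DecidableEq α] (M A : Finset α) :
    (#{π : Equiv.Perm α | ∀ x ∈ A, π.symm x ∈ M} : ℝ) ≤
      ((#M : ℝ) / Fintype.card α) ^ #A * Fintype.card (Equiv.Perm α) := by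
  induction A using Finset.induction_on with
  | empty => simp
  | insert x A hx ih =>
    set f : Finset α → ℕ := fun A => #{π : Equiv.Perm α | ∀ x ∈ A, π.symm x ∈ M} with hf
    have hsymm : ∀ y ∈ Aᶜ, f (insert y A) = f (insert x A) := by
      intro y hy
      rw [mem_compl] at hy
      refine card_equiv (Equiv.mulLeft (Equiv.swap x y)) fun π => ?_
      simp only [mem_filter, mem_univ, true_and, Equiv.coe_mulLeft, forall_mem_insert]
      have h1 : ∀ z, (Equiv.swap x y * π).symm z = π.symm (Equiv.swap x y z) := fun z => rfl
      simp only [h1, Equiv.swap_apply_left]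
      refine and_congr_right fun _ => forall₂_congr fun z hz => ?_
      rw [Equiv.swap_apply_of_ne_of_ne (ne_of_mem_of_not_mem hz hx) (ne_of_mem_of_not_mem hz hy)]
    have hpre : ∀ π : Equiv.Perm α, #{y | π.symm y ∈ M} = #M := by
      intro π
      refine card_equiv π.symm fun y => by simp
    have hcount : (#Aᶜ) * f (insert x A) = (#M - #A) * f A := by
      have h1 : ∑ y ∈ Aᶜ, f (insert y A) = #Aᶜ * f (insert x A) := by
        rw [sum_congr rfl hsymm, sum_const, smul_eq_mul]
      rw [← h1]
      simp only [f, card_filter, forall_mem_insert]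
      rw [sum_comm, mul_sum]
      refine sum_congr rfl fun π _ => ?_
      by_cases hπ : ∀ z ∈ A, π.symm z ∈ M
      · simp only [and_iff_left hπ, if_pos hπ, mul_one]
        rw [← card_filter, ← hpre π, ← card_sdiff_of_subset]
        · congr 1; ext y; simp [and_comm]
        · intro z hz; simpa using hπ z hz
      · simp [hπ]
    have hA : #A < Fintype.card α := by
      rw [← card_univ]; exact card_lt_card (ssubset_univ_iff.2 fun h => hx (h ▸ mem_univ x))
    have hM : #M ≤ Fintype.card α := card_le_univ M
    have hle : f (insert x A) * Fintype.card α ≤ #M * f A := by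
      rw [card_compl] at hcount
      have h2 : (Fintype.card α - #A) * (f (insert x A) * Fintype.card α) ≤
          (Fintype.card α - #A) * (#M * f A) := by
        rw [← mul_assoc, hcount]
        calc (#M - #A) * f A * Fintype.card α = ((#M - #A) * Fintype.card α) * f A := by ring
          _ ≤ ((Fintype.card α - #A) * #M) * f A := by
            refine Nat.mul_le_mul_right _ ?_
            rw [Nat.sub_mul, Nat.sub_mul, mul_comm (#M)]
            exact Nat.sub_le_sub_left (by gcongr) _
          _ = _ := by ring
      exact Nat.le_of_mul_le_mul_left h2 (by omega)
    have hpos : (0 : ℝ) < Fintype.card α := by exact_mod_cast (by omega : 0 < Fintype.card α)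
    rw [card_insert_of_notMem hx, pow_succ']
    calc (f (insert x A) : ℝ) ≤ (#M : ℝ) / Fintype.card α * f A := by
          rw [div_mul_eq_mul_div, le_div_iff₀ hpos]; exact_mod_cast hle
      _ ≤ (#M : ℝ) / Fintype.card α *
          (((#M : ℝ) / Fintype.card α) ^ #A * Fintype.card (Equiv.Perm α)) := by gcongr
      _ = _ := by ring

open Finset in
/-- A random subset of `J` that contains each `I` with probability at most `p ^ #I` has the
generating function of its size bounded by that of a binomial variable. -/
theorem sum_one_add_pow_card_le {Ω ι : Type*} [Fintype Ω] [DecidableEq ι] (B : Ω → Finset ι)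
    (J : Finset ι) (hB : ∀ ω, B ω ⊆ J) (p w : ℝ) (hw : 0 ≤ w)
    (h : ∀ I ⊆ J, (#{ω | I ⊆ B ω} : ℝ) ≤ p ^ #I * Fintype.card Ω) :
    ∑ ω, (1 + w) ^ #(B ω) ≤ (1 + w * p) ^ #J * Fintype.card Ω := by
  have key : ∀ ω, (1 + w) ^ #(B ω) = ∑ I ∈ J.powerset, if I ⊆ B ω then w ^ #I else 0 := by
    intro ω
    rw [← sum_filter, add_comm, ← sum_pow_mul_eq_add_pow]
    simp only [one_pow, mul_one]
    refine sum_congr ?_ fun _ _ => rfl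
    ext I
    simp only [mem_powerset, mem_filter]
    exact ⟨fun hI => ⟨hI.trans (hB ω), hI⟩, fun hI => hI.2⟩
  simp only [key]
  rw [sum_comm, add_comm, ← sum_pow_mul_eq_add_pow, sum_mul]
  refine sum_le_sum fun I hI => ?_
  rw [← sum_filter, sum_const, nsmul_eq_mul, one_pow, mul_one, mul_pow, mul_comm, mul_assoc]
  exact mul_le_mul_of_nonneg_left (h I (mem_powerset.1 hI)) (by positivity)

open Finset in
/-- Joint upper tail bound: the probability that the image of `M` is large in every block `W i`, `i ∈ I`. -/
theorem card_perm_forall_block_le {α ι : Type*} [Fintype α] [DecidableEq α] [DecidableEq ι]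
    (M : Finset α) (W : ι → Finset α) (I : Finset ι) (hW : (I : Set ι).PairwiseDisjoint W) (w : ℕ)
    (hw : ∀ i ∈ I, #(W i) = w) (K s : ℝ) (hs : 0 ≤ s) :
    (#{π : Equiv.Perm α | ∀ i ∈ I, K < #{x ∈ W i | π.symm x ∈ M}} : ℝ) ≤
      (Real.exp (-s * K) * (1 + (Real.exp s - 1) * ((#M : ℝ) / Fintype.card α)) ^ w) ^ #I *
        Fintype.card (Equiv.Perm α) := by
  set U := I.biUnion W with hU
  have hUc : #U = w * #I := by
    rw [card_biUnion hW, sum_congr rfl hw, sum_const, smul_eq_mul, mul_comm]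
  have h1 : ∑ π : Equiv.Perm α, (1 + (Real.exp s - 1)) ^ #{x ∈ U | π.symm x ∈ M} ≤
      (1 + (Real.exp s - 1) * ((#M : ℝ) / Fintype.card α)) ^ #U *
        Fintype.card (Equiv.Perm α) := by
    refine sum_one_add_pow_card_le (fun π : Equiv.Perm α => {x ∈ U | π.symm x ∈ M}) U
      (fun _ => filter_subset _ _) _ _ (by linarith [Real.one_le_exp hs]) fun A hA => ?_
    refine le_trans (Nat.cast_le.2 (card_le_card fun π hπ => ?_))
      (card_perm_forall_symm_mem_le M A)
    simp only [mem_filter, mem_univ, true_and] at hπ ⊢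
    exact fun x hx => (mem_filter.1 (hπ hx)).2
  have h2 : ∀ π : Equiv.Perm α, (∀ i ∈ I, K < #{x ∈ W i | π.symm x ∈ M}) →
      Real.exp (s * (K * #I)) ≤ (1 + (Real.exp s - 1)) ^ #{x ∈ U | π.symm x ∈ M} := by
    intro π hπ
    rw [add_sub_cancel, ← Real.exp_nat_mul, mul_comm _ s]
    gcongr
    rw [hU, filter_biUnion, card_biUnion]
    · push_cast
      rw [mul_comm, ← nsmul_eq_mul]
      exact card_nsmul_le_sum _ _ _ fun i hi => (hπ i hi).le
    · exact fun i hi j hj hij => (hW hi hj hij).mono (filter_subset _ _) (filter_subset _ _)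
  have h3 : (#{π : Equiv.Perm α | ∀ i ∈ I, K < #{x ∈ W i | π.symm x ∈ M}} : ℝ) *
      Real.exp (s * (K * #I)) ≤
        ∑ π : Equiv.Perm α, (1 + (Real.exp s - 1)) ^ #{x ∈ U | π.symm x ∈ M} := by
    rw [← nsmul_eq_mul]
    refine (card_nsmul_le_sum _ _ _ fun π hπ => h2 π (by simpa using hπ)).trans ?_
    refine sum_le_sum_of_subset_of_nonneg (filter_subset _ _) fun π _ _ => ?_
    rw [add_sub_cancel]; positivity
  have h4 : Real.exp (s * (K * #I)) * Real.exp (-s * K) ^ #I = 1 := by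
    rw [← Real.exp_nat_mul, ← Real.exp_add]
    simp only [Real.exp_eq_one_iff]; ring
  have h5 := h3.trans h1
  rw [hUc, pow_mul] at h5
  rw [mul_pow]
  have := mul_le_mul_of_nonneg_right h5 (by positivity : 0 ≤ Real.exp (-s * K) ^ #I)
  rw [mul_assoc, h4, mul_one] at this
  linarith

open Finset in
/-- Chernoff-type upper tail bound for the size of a random subset of `J` as in
`sum_one_add_pow_card_le`. -/
theorem card_lt_card_subset_le_exp {Ω ι : Type*} [Fintype Ω] [DecidableEq ι] (B : Ω → Finset ι)
    (J : Finset ι) (hB : ∀ ω, B ω ⊆ J) (p γ : ℝ) (hp : 0 ≤ p)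
    (h : ∀ I ⊆ J, (#{ω | I ⊆ B ω} : ℝ) ≤ p ^ #I * Fintype.card Ω) :
    (#{ω | γ * #J < #(B ω)} : ℝ) ≤ Real.exp (#J * (2 * p - γ)) * Fintype.card Ω := by
  have h1 := sum_one_add_pow_card_le B J hB p 2 zero_le_two h
  have h2 : (#{ω | γ * #J < #(B ω)} : ℝ) * Real.exp (γ * #J) ≤ ∑ ω, (1 + 2 : ℝ) ^ #(B ω) := by
    rw [← nsmul_eq_mul]
    refine (card_nsmul_le_sum _ (fun ω => (1 + 2 : ℝ) ^ #(B ω)) _ fun ω hω => ?_).trans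
      (sum_le_sum_of_subset_of_nonneg (filter_subset _ _) fun π _ _ => by positivity)
    have hω : γ * #J < #(B ω) := by simpa using hω
    calc Real.exp (γ * #J) ≤ Real.exp (#(B ω) * 1) := by rw [mul_one]; gcongr
      _ = Real.exp 1 ^ #(B ω) := Real.exp_nat_mul _ _
      _ ≤ _ := by gcongr; linarith [Real.exp_one_lt_d9]
  have h3 : (1 + 2 * p) ^ #J ≤ Real.exp (#J * (2 * p)) := by
    rw [Real.exp_nat_mul]
    gcongr
    linarith [Real.add_one_le_exp (2 * p)]
  have h4 : Real.exp (#J * (2 * p - γ)) = Real.exp (#J * (2 * p)) / Real.exp (γ * #J) := by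
    rw [← Real.exp_sub]; ring_nf
  rw [h4, div_mul_eq_mul_div, le_div_iff₀ (Real.exp_pos _)]
  exact h2.trans (h1.trans (by gcongr))

theorem exp_neg_mul_one_add_le {β η : ℝ} (hβ : 0 ≤ β) (hβ1 : β ≤ 1) (hη : 0 ≤ η) (hη1 : η ≤ 2) :
    Real.exp (-(η / 2) * (β + η)) * (1 + (Real.exp (η / 2) - 1) * β) ≤
      Real.exp (-(η ^ 2 / 4)) := by
  have h := (abs_le.1 (Real.abs_exp_sub_one_sub_id_le
    (abs_le.2 ⟨by linarith, by linarith⟩ : |η / 2| ≤ 1))).2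
  have h1 : 1 + (Real.exp (η / 2) - 1) * β ≤ Real.exp ((η / 2 + (η / 2) ^ 2) * β) := by
    refine le_trans ?_ (Real.add_one_le_exp _)
    nlinarith
  calc _ ≤ Real.exp (-(η / 2) * (β + η)) * Real.exp ((η / 2 + (η / 2) ^ 2) * β) := by gcongr
    _ ≤ _ := by
      rw [← Real.exp_add]
      gcongr
      nlinarith [sq_nonneg η]

open Finset in
/-- If few blocks are marked for every element of `α`, then after a random permutation few blocks
contain an element for which they are marked. -/
theorem card_perm_many_blocks_hit_mul_le {α ι : Type*} [Fintype α] [DecidableEq α] [DecidableEq ι]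
    (W : ι → Finset α) (J : Finset ι) (w : ℕ) (hw : ∀ i ∈ J, #(W i) = w) (B : α → Finset ι)
    (hBJ : ∀ v, B v ⊆ J) (b δ : ℝ) (hb : ∀ v, (#(B v) : ℝ) ≤ b) (hb0 : 0 ≤ b) :
    (#{σ : Equiv.Perm α | δ < #{i ∈ J | ∃ x ∈ W i, i ∈ B (σ.symm x)}} : ℝ) * δ ≤
      w * b * Fintype.card (Equiv.Perm α) := by
  have h1 : (#{σ : Equiv.Perm α | δ < #{i ∈ J | ∃ x ∈ W i, i ∈ B (σ.symm x)}} : ℝ) * δ ≤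
      ∑ σ : Equiv.Perm α, (#{i ∈ J | ∃ x ∈ W i, i ∈ B (σ.symm x)} : ℝ) := by
    rw [← nsmul_eq_mul]
    refine (card_nsmul_le_sum _ _ _ fun σ hσ => (mem_filter.1 hσ).2.le).trans
      (sum_le_sum_of_subset_of_nonneg (filter_subset _ _) fun _ _ _ => by positivity)
  have h2 : ∀ σ : Equiv.Perm α, (#{i ∈ J | ∃ x ∈ W i, i ∈ B (σ.symm x)} : ℝ) ≤
      ∑ i ∈ J, ∑ x ∈ W i, if i ∈ B (σ.symm x) then (1 : ℝ) else 0 := by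
    intro σ
    rw [card_filter]
    push_cast
    refine sum_le_sum fun i _ => ?_
    split_ifs with h
    · obtain ⟨x, hx, hi⟩ := h
      refine le_trans ?_ (single_le_sum (fun y _ => by split_ifs <;> norm_num) hx)
      rw [if_pos hi]
    · exact sum_nonneg fun y _ => by split_ifs <;> norm_num
  have h3 : ∀ i x, ∑ σ : Equiv.Perm α, (if i ∈ B (σ.symm x) then (1 : ℝ) else 0) ≤
      (#{v | i ∈ B v} : ℝ) / Fintype.card α * Fintype.card (Equiv.Perm α) := by
    intro i x
    have := card_perm_forall_symm_mem_le ({v | i ∈ B v} : Finset α) {x}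
    simpa using this
  have h4 : ∑ i ∈ J, (#{v | i ∈ B v} : ℝ) ≤ Fintype.card α * b := by
    have : ∑ i ∈ J, (#{v | i ∈ B v} : ℝ) = ∑ v, (#(B v) : ℝ) := by
      simp only [card_filter]
      push_cast
      rw [sum_comm]
      refine sum_congr rfl fun v _ => ?_
      rw [← sum_filter, filter_mem_eq_inter, inter_eq_right.2 (hBJ v)]
      simp
    rw [this]
    refine (sum_le_card_nsmul _ _ b fun v _ => hb v).trans ?_
    simp
  calc _ ≤ _ := h1
    _ ≤ ∑ σ : Equiv.Perm α, ∑ i ∈ J, ∑ x ∈ W i, if i ∈ B (σ.symm x) then (1 : ℝ) else 0 :=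
        sum_le_sum fun σ _ => h2 σ
    _ = ∑ i ∈ J, ∑ x ∈ W i, ∑ σ : Equiv.Perm α, if i ∈ B (σ.symm x) then (1 : ℝ) else 0 := by
        rw [sum_comm]
        exact sum_congr rfl fun i _ => sum_comm
    _ ≤ ∑ i ∈ J, ∑ x ∈ W i,
          (#{v | i ∈ B v} : ℝ) / Fintype.card α * Fintype.card (Equiv.Perm α) :=
        sum_le_sum fun i _ => sum_le_sum fun x _ => h3 i x
    _ = w * (∑ i ∈ J, (#{v | i ∈ B v} : ℝ)) / Fintype.card α *
          Fintype.card (Equiv.Perm α) := by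
        rw [mul_sum, sum_div, sum_mul]
        refine sum_congr rfl fun i hi => ?_
        rw [sum_const, hw i hi, nsmul_eq_mul]
        ring
    _ ≤ w * (Fintype.card α * b) / Fintype.card α * Fintype.card (Equiv.Perm α) := by gcongr
    _ ≤ _ := by
        rw [mul_left_comm]
        gcongr
        exact div_le_of_le_mul₀ (by positivity) (by positivity) (by rw [mul_comm])

section Spread

variable {α ι : Type*} [Fintype α] [DecidableEq α]

open Finset Classical in
/-- The indices `i ∈ J` for which `v` has at least `η w` more non-neighbours than expected in the
`i`-th random block. -/
noncomputable def deficientBlocks (Adj : α → α → Prop) (W : ι → Finset α) (J : Finset ι) (w : ℕ)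
    (η : ℝ) (τ : Equiv.Perm α) (v : α) : Finset ι :=
  {i ∈ J | w * ((#{u | ¬ Adj v u} : ℝ) / Fintype.card α + η) <
    #{x ∈ W i | τ.symm x ∈ ({u | ¬ Adj v u} : Finset α)}}

open Finset Classical in
/-- Every vertex has at most `γ #J` deficient blocks, and at most `δ` blocks contain a vertex for
which they are deficient. -/
def IsWellSpread (Adj : α → α → Prop) (W : ι → Finset α) (J : Finset ι) (w : ℕ)
    (η γ δ : ℝ) (π : Equiv.Perm α × Equiv.Perm α) : Prop :=
  (∀ v, (#(deficientBlocks Adj W J w η π.2 v) : ℝ) ≤ γ * #J) ∧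
    (#{i ∈ J | ∃ x ∈ W i, i ∈ deficientBlocks Adj W J w η π.2 (π.1.symm x)} : ℝ) ≤ δ

open Finset Classical in
theorem card_perm_exists_many_deficientBlocks_le (Adj : α → α → Prop) (W : ι → Finset α)
    (J : Finset ι) (hW : (J : Set ι).PairwiseDisjoint W) (w : ℕ) (hw : ∀ i ∈ J, #(W i) = w)
    (η γ : ℝ) (hη : 0 ≤ η) (hη2 : η ≤ 2) :
    (#{τ : Equiv.Perm α | ∃ v, γ * #J < #(deficientBlocks Adj W J w η τ v)} : ℝ) ≤
      Fintype.card α * Real.exp (#J * (2 * Real.exp (-(η ^ 2 / 4)) ^ w - γ)) *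
        Fintype.card (Equiv.Perm α) := by
  have h1 : ∀ v, (#{τ : Equiv.Perm α | γ * #J < #(deficientBlocks Adj W J w η τ v)} : ℝ) ≤
      Real.exp (#J * (2 * Real.exp (-(η ^ 2 / 4)) ^ w - γ)) * Fintype.card (Equiv.Perm α) := by
    intro v
    refine card_lt_card_subset_le_exp _ J (fun τ => filter_subset _ _) _ _ (by positivity)
      fun I hI => ?_
    set M : Finset α := {u | ¬ Adj v u}
    set β : ℝ := (#M : ℝ) / Fintype.card α
    have hβ : 0 ≤ β := by positivity
    have hβ1 : β ≤ 1 := div_le_one_of_le₀ (by exact_mod_cast card_le_univ M) (by positivity)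
    have h := card_perm_forall_block_le M W I (hW.subset hI) w (fun i hi => hw i (hI hi))
      (w * (β + η)) (η / 2) (by positivity)
    refine le_trans (Nat.cast_le.2 (card_le_card fun τ hτ => ?_)) (h.trans ?_)
    · simp only [mem_filter, mem_univ, true_and] at hτ ⊢
      exact fun i hi => (mem_filter.1 (hτ hi)).2
    · have hpos : 0 ≤ 1 + (Real.exp (η / 2) - 1) * β := by
        have := Real.one_le_exp (by positivity : 0 ≤ η / 2)
        have : 0 ≤ (Real.exp (η / 2) - 1) * β := mul_nonneg (by linarith) hβ
        linarith
      have hexp : Real.exp (-(η / 2) * (w * (β + η))) = Real.exp (-(η / 2) * (β + η)) ^ w := by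
        rw [← Real.exp_nat_mul]; ring_nf
      rw [hexp, ← mul_pow]
      gcongr
      exact exp_neg_mul_one_add_le hβ hβ1 hη hη2
  calc (#{τ : Equiv.Perm α | ∃ v, γ * #J < #(deficientBlocks Adj W J w η τ v)} : ℝ)
      ≤ ∑ v : α, (#{τ : Equiv.Perm α | γ * #J < #(deficientBlocks Adj W J w η τ v)} : ℝ) := by
        rw [← Nat.cast_sum]
        refine Nat.cast_le.2 (le_trans (card_le_card fun τ hτ => ?_) card_biUnion_le)
        simpa using hτ
    _ ≤ _ := by
        refine (sum_le_card_nsmul _ _ _ fun v _ => h1 v).trans ?_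
        rw [nsmul_eq_mul, card_univ, mul_assoc]

open Finset Classical in
/-- A pair of random permutations is rarely not well spread. -/
theorem card_not_isWellSpread_le (Adj : α → α → Prop) (W : ι → Finset α)
    (J : Finset ι) (hW : (J : Set ι).PairwiseDisjoint W) (w : ℕ) (hw : ∀ i ∈ J, #(W i) = w)
    (η γ δ : ℝ) (hη : 0 ≤ η) (hη2 : η ≤ 2) (hγ : 0 ≤ γ) (hδ : 0 < δ) :
    (#{π : Equiv.Perm α × Equiv.Perm α | ¬ IsWellSpread Adj W J w η γ δ π} : ℝ) ≤
      (Fintype.card α * Real.exp (#J * (2 * Real.exp (-(η ^ 2 / 4)) ^ w - γ)) +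
        w * (γ * #J) / δ) * (Fintype.card (Equiv.Perm α)) ^ 2 := by
  set N : ℝ := ((Fintype.card (Equiv.Perm α) : ℕ) : ℝ) with hN
  set S : Finset (Equiv.Perm α) :=
    {τ | ∃ v, γ * #J < #(deficientBlocks Adj W J w η τ v)} with hS
  set Z : Equiv.Perm α → Finset (Equiv.Perm α) := fun τ =>
    {σ | δ < #{i ∈ J | ∃ x ∈ W i, i ∈ deficientBlocks Adj W J w η τ (σ.symm x)}} with hZ
  have hsub : ({π : Equiv.Perm α × Equiv.Perm α | ¬ IsWellSpread Adj W J w η γ δ π} : Finset _) ⊆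
      univ ×ˢ S ∪ Sᶜ.biUnion fun τ => Z τ ×ˢ {τ} := by
    rintro ⟨σ, τ⟩ h
    simp only [mem_filter, mem_univ, true_and, IsWellSpread, not_and_or, not_forall,
      not_le] at h
    simp only [mem_union, mem_product, mem_univ, true_and, mem_biUnion, mem_compl,
      mem_singleton]
    by_cases hτ : τ ∈ S
    · exact Or.inl hτ
    · refine Or.inr ⟨τ, hτ, ?_, rfl⟩
      rw [hS, mem_filter] at hτ
      simp only [hZ, mem_filter, mem_univ, true_and]
      exact h.resolve_left fun h' => hτ ⟨mem_univ _, h'⟩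
  have hZle : ∀ τ ∈ Sᶜ, (#(Z τ ×ˢ {τ}) : ℝ) ≤ w * (γ * #J) / δ * N := by
    intro τ hτ
    simp only [hS, mem_compl, mem_filter, mem_univ, true_and, not_exists, not_lt] at hτ
    rw [card_product, card_singleton, mul_one, div_mul_eq_mul_div, le_div_iff₀ hδ]
    convert card_perm_many_blocks_hit_mul_le W J w hw (deficientBlocks Adj W J w η τ)
      (fun v => filter_subset _ _) (γ * #J) δ hτ (by positivity)
  calc (#{π : Equiv.Perm α × Equiv.Perm α | ¬ IsWellSpread Adj W J w η γ δ π} : ℝ)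
      ≤ (#(univ ×ˢ S ∪ Sᶜ.biUnion fun τ => Z τ ×ˢ {τ}) : ℝ) := by
        exact_mod_cast card_le_card hsub
    _ ≤ N * #S + ∑ τ ∈ Sᶜ, (#(Z τ ×ˢ {τ}) : ℝ) := by
        have h1 := card_union_le (univ ×ˢ S) (Sᶜ.biUnion fun τ => Z τ ×ˢ {τ})
        have h2 : #(Sᶜ.biUnion fun τ => Z τ ×ˢ {τ}) ≤ ∑ τ ∈ Sᶜ, #(Z τ ×ˢ {τ}) := card_biUnion_le
        rw [card_product, card_univ] at h1
        have h3 := (Nat.cast_le (α := ℝ)).2 (h1.trans (Nat.add_le_add_left h2 _))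
        rwa [Nat.cast_add, Nat.cast_mul, Nat.cast_sum] at h3
    _ ≤ N * (Fintype.card α * Real.exp (#J * (2 * Real.exp (-(η ^ 2 / 4)) ^ w - γ)) * N) +
          N * (w * (γ * #J) / δ * N) := by
        gcongr
        · exact card_perm_exists_many_deficientBlocks_le Adj W J hW w hw η γ hη hη2
        · refine (sum_le_card_nsmul _ _ _ hZle).trans ?_
          rw [nsmul_eq_mul]
          gcongr
          exact Nat.cast_le.2 (card_le_univ _)
    _ = _ := by ring

open Finset Classical in
theorem le_card_neighbors_of_notMem_deficientBlocks {Adj : α → α → Prop} {W : ι → Finset α}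
    {J : Finset ι} {w : ℕ} {η : ℝ} {τ : Equiv.Perm α} {v : α} {i : ι} (hi : i ∈ J)
    (hw : #(W i) = w) (h : i ∉ deficientBlocks Adj W J w η τ v) :
    w * ((#{u | Adj v u} : ℝ) / Fintype.card α - η) ≤ #{u | τ u ∈ W i ∧ Adj v u} := by
  simp only [deficientBlocks, mem_filter, hi, true_and, not_lt] at h
  have h1 : #{u | Adj v u} + #{u | ¬ Adj v u} = Fintype.card α := by
    rw [← card_univ, card_filter_add_card_filter_not]
  have h2 : #{u | τ u ∈ W i ∧ Adj v u} = #{x ∈ W i | Adj v (τ.symm x)} :=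
    card_equiv τ fun u => by simp
  have h3 : #{x ∈ W i | Adj v (τ.symm x)} + #{x ∈ W i | ¬ Adj v (τ.symm x)} = w := by
    rw [← hw, card_filter_add_card_filter_not]
  have hpos : (0 : ℝ) < Fintype.card α := by exact_mod_cast Fintype.card_pos_iff.2 ⟨v⟩
  have h4 : (#{u | Adj v u} : ℝ) / Fintype.card α =
      1 - (#{u | ¬ Adj v u} : ℝ) / Fintype.card α := by
    rw [eq_sub_iff_add_eq, ← add_div, div_eq_one_iff_eq hpos.ne']
    exact_mod_cast h1
  have h5 : (#{x ∈ W i | Adj v (τ.symm x)} : ℝ) + #{x ∈ W i | ¬ Adj v (τ.symm x)} = w := by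
    exact_mod_cast h3
  simp only [mem_univ, true_and] at h
  rw [h2, h4]
  linarith

end Spread

open Finset in
theorem card_filter_clusterIndex {n r w m i : ℕ} (hw : 0 < w) (hn : r + w * m = n)
    (hi : i ∈ Icc 2 (m + 1)) : #{x : Fin n | clusterIndex r w x = i} = w := by
  rw [mem_Icc] at hi
  obtain ⟨k, rfl⟩ := Nat.exists_eq_add_of_le' hi.1
  have hk : k + 1 ≤ m := by omega
  have hmul : w * (k + 1) ≤ w * m := Nat.mul_le_mul_left w hk
  rw [← card_map Fin.valEmbedding]
  have : ({x : Fin n | clusterIndex r w x = k + 2} : Finset (Fin n)).map Fin.valEmbedding =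
      Ico (r + w * k) (r + w * k + w) := by
    ext x
    simp only [mem_map, mem_filter, mem_univ, true_and, Fin.valEmbedding_apply, mem_Ico]
    simp only [clusterIndex]
    constructor
    · rintro ⟨y, hy, rfl⟩
      split_ifs at hy with h
      · omega
      · have hdiv : (y.val - r) / w = k := by omega
        have h1 := Nat.div_add_mod (y.val - r) w
        have h2 := Nat.mod_lt (y.val - r) hw
        rw [hdiv] at h1
        omega
    · rintro ⟨h1, h2⟩
      rw [mul_add, mul_one] at hmul
      refine ⟨⟨x, by omega⟩, ?_, rfl⟩
      have h3 : ¬ x < r := by omega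
      have h4 : (x - r) / w = k := by
        rw [Nat.div_eq_iff hw]
        rw [mul_comm k]
        omega
      simp only [h3, if_false, h4]
  rw [this, Nat.card_Ico]
  omega

open Finset in
/-- The positions making up the `i`-th interval. -/
def clusterPositions (n C i : ℕ) : Finset (Fin n) :=
  {x : Fin n | clusterIndex ((C - 1) * C + n % ((C - 1) * C)) (C - 1) x = i}

theorem numClustersBip_eq {n C m : ℕ} (hC : 2 ≤ C) (hn : 2 * C ^ 2 ≤ n)
    (hm : m = (n - ((C - 1) * C + n % ((C - 1) * C))) / (C - 1)) :
    ((C - 1) * C + n % ((C - 1) * C)) + (C - 1) * m = n ∧ n ≤ C * m + 2 * C ^ 2 := by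
  obtain ⟨c, rfl⟩ := Nat.exists_eq_add_of_le' hC
  have hc : c + 2 - 1 = c + 1 := rfl
  rw [hc] at hm ⊢
  set a := (c + 1) * (c + 2) with ha
  have hlt : n % a < a := Nat.mod_lt _ (by positivity)
  have hdm := Nat.div_add_mod n a
  have ha2 : a ≤ (c + 2) ^ 2 := by rw [ha]; nlinarith
  have hdvd : (c + 1) ∣ n - (a + n % a) := by
    have : n - (a + n % a) = a * (n / a) - a := by omega
    rw [this]
    exact Nat.dvd_sub ((Dvd.intro _ rfl : c + 1 ∣ a).mul_right _) (Dvd.intro _ rfl)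
  have hmul : (c + 1) * m = n - (a + n % a) := by rw [hm, Nat.mul_div_cancel' hdvd]
  refine ⟨by omega, ?_⟩
  have : (c + 1) * m ≤ (c + 2) * m := by gcongr; omega
  omega

open Filter Topology in
theorem exists_forall_cluster_size (ε : ℝ) (hε : 0 < ε) (b : ℝ) (hb : 0 < b) :
    ∃ C₀ : ℕ, ∀ C : ℕ, C₀ ≤ C → 2 ≤ C ∧ 1 + 3 * ε / 4 ≤ C * ε / 4 ∧
      Real.exp (-b) ^ (C - 1) ≤ 1 / (6400 * (C : ℝ) ^ 2) := by
  have h1 : Tendsto (fun C : ℕ => (C : ℝ) ^ (2 : ℝ) * Real.exp (-b * C)) atTop (𝓝 0) :=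
    (tendsto_rpow_mul_exp_neg_mul_atTop_nhds_zero 2 b hb).comp tendsto_natCast_atTop_atTop
  have h2 := h1.eventually_le_const (u := Real.exp (-b) / 6400) (by positivity)
  have h3 := tendsto_natCast_atTop_atTop.eventually_ge_atTop ((1 + 3 * ε / 4) * 4 / ε)
  obtain ⟨C₀, h⟩ := eventually_atTop.1 ((h2.and h3).and (eventually_ge_atTop 2))
  refine ⟨C₀, fun C hC => ?_⟩
  obtain ⟨⟨h4, h5⟩, h6⟩ := h C hC
  have hC0 : (0 : ℝ) < C := by exact_mod_cast (by omega : 0 < C)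
  refine ⟨h6, ?_, ?_⟩
  · rw [div_le_iff₀ hε] at h5
    linarith
  · rw [le_div_iff₀ (by positivity)]
    have h7 : Real.exp (-b * C) = Real.exp (-b) ^ (C - 1) * Real.exp (-b) := by
      rw [← pow_succ, Nat.sub_add_cancel (by omega), ← Real.exp_nat_mul, mul_comm]
    rw [h7, Real.rpow_two] at h4
    have hpos := Real.exp_pos (-b)
    refine le_of_mul_le_mul_right ?_ hpos
    linarith

open Filter Topology in
theorem exists_forall_mul_exp_le (b c : ℝ) (hb : 0 < b) (C : ℕ) :
    ∃ n₀ : ℕ, ∀ n : ℕ, n₀ ≤ n → C ≤ n ∧ n * Real.exp (c - b * n) ≤ 1 / 400 := by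
  have h1 : Tendsto (fun n : ℕ => (n : ℝ) ^ (1 : ℝ) * Real.exp (-b * n)) atTop (𝓝 0) :=
    (tendsto_rpow_mul_exp_neg_mul_atTop_nhds_zero 1 b hb).comp tendsto_natCast_atTop_atTop
  have h2 := h1.eventually_le_const (u := Real.exp (-c) / 400) (by positivity)
  obtain ⟨n₀, h⟩ := eventually_atTop.1 (h2.and (eventually_ge_atTop C))
  refine ⟨n₀, fun n hn => ⟨(h n hn).2, ?_⟩⟩
  have h3 := (h n hn).1
  rw [Real.rpow_one] at h3
  have h4 : Real.exp (c - b * n) = Real.exp (-b * n) * Real.exp c := by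
    rw [← Real.exp_add]; ring_nf
  have h5 : Real.exp (-c) * Real.exp c = 1 := by rw [← Real.exp_add]; simp
  rw [h4, ← mul_assoc]
  have := mul_le_mul_of_nonneg_right h3 (Real.exp_pos c).le
  linarith

open Finset Classical in
/-- On a pair of permutations that is well spread for `Adj` and for its transpose, most clusters
satisfy the degree condition, whatever the sets `T₁` and `T₂`. -/
theorem le_card_filter_of_isWellSpread {n C m : ℕ} {ε γ : ℝ} (hC : 2 ≤ C)
    (hCε : 1 + 3 * ε / 4 ≤ C * ε / 4) (hm : m + 1 = numClustersBip n C)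
    (hn : ((C - 1) * C + n % ((C - 1) * C)) + (C - 1) * m = n) (hmC : 4 * C ≤ m)
    (hγ : γ ≤ 1 / (8 * C)) (Adj : Fin n → Fin n → Prop)
    (hdeg : ∀ a b : Fin n, (1 + ε) * n ≤ (#{b' | Adj a b'} : ℝ) + #{a' | Adj a' b})
    (π : Equiv.Perm (Fin n) × Equiv.Perm (Fin n))
    (h₁ : IsWellSpread Adj (clusterPositions n C) (Icc 2 (m + 1)) (C - 1) (ε / 8) γ (m / (4 * C)) π)
    (h₂ : IsWellSpread (flip Adj) (clusterPositions n C) (Icc 2 (m + 1)) (C - 1) (ε / 8) γ (m / (4 * C)) π.swap)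
    (T₁ T₂ : Finset (Fin n)) (hT₁ : #T₁ ≤ 1) (hT₂ : #T₂ ≤ 1) :
    (1 - 1 / (C : ℝ)) * (numClustersBip n C : ℝ) ≤
      (#{i ∈ Icc 2 (numClustersBip n C) |
        ∀ v ∈ bipCluster n C i π.1 ∪ T₁, ∀ u ∈ bipCluster n C i π.2 ∪ T₂,
          (1 + ε / 2) * (C : ℝ) ≤
            (#{b ∈ bipCluster n C i π.2 ∪ T₂ | Adj v b} : ℝ) +
              #{a ∈ bipCluster n C i π.1 ∪ T₁ | Adj a u}} : ℝ) := by
  rw [← hm]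
  set W := clusterPositions n C with hW
  set J := Icc 2 (m + 1) with hJ
  have hJc : #J = m := by rw [hJ, Nat.card_Icc]; omega
  set D₁ := deficientBlocks Adj W J (C - 1) (ε / 8) π.2 with hD₁
  set D₂ := deficientBlocks (flip Adj) W J (C - 1) (ε / 8) π.1 with hD₂
  have hWc : ∀ i ∈ J, #(W i) = C - 1 := fun i hi => by
    exact card_filter_clusterIndex (by omega) hn hi
  have hmem : ∀ i (σ : Equiv.Perm (Fin n)) v, v ∈ bipCluster n C i σ ↔ σ v ∈ W i := by
    intro i σ v; simp [bipCluster, hW, clusterPositions]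
  set Z₁ : Finset ℕ := {i ∈ J | ∃ x ∈ W i, i ∈ D₁ (π.1.symm x)} with hZ₁
  set Z₂ : Finset ℕ := {i ∈ J | ∃ x ∈ W i, i ∈ D₂ (π.2.symm x)} with hZ₂
  have hTD : ∀ (T : Finset (Fin n)) (D : Fin n → Finset ℕ), #T ≤ 1 →
      (∀ v, (#(D v) : ℝ) ≤ γ * m) → (#(T.biUnion D) : ℝ) ≤ m / (8 * C) := by
    intro T D hT hD
    have hγm : γ * m ≤ m / (8 * C) := by
      calc γ * m ≤ 1 / (8 * C) * m := by gcongr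
        _ = _ := by ring
    rcases Nat.le_one_iff_eq_zero_or_eq_one.1 hT with h | h
    · rw [card_eq_zero.1 h]
      simp only [biUnion_empty, card_empty, Nat.cast_zero]
      positivity
    · obtain ⟨t, rfl⟩ := card_eq_one.1 h
      rw [singleton_biUnion]
      exact (hD t).trans hγm
  have hs₁ := hTD T₁ D₁ hT₁ (by rw [← hJc]; exact h₁.1)
  have hs₂ := hTD T₂ D₂ hT₂ (by rw [← hJc]; exact h₂.1)
  have hz₁ : (#Z₁ : ℝ) ≤ m / (4 * C) := by convert h₁.2
  have hz₂ : (#Z₂ : ℝ) ≤ m / (4 * C) := by convert h₂.2 <;> rfl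
  set X := (T₁.biUnion D₁ ∪ T₂.biUnion D₂) ∪ (Z₁ ∪ Z₂) with hX
  have hXc : (#X : ℝ) ≤ 3 * m / (4 * C) := by
    have h1 : #X ≤ (#(T₁.biUnion D₁) + #(T₂.biUnion D₂)) + (#Z₁ + #Z₂) :=
      (card_union_le _ _).trans (add_le_add (card_union_le _ _) (card_union_le _ _))
    have h2 : (#X : ℝ) ≤ (#(T₁.biUnion D₁) + #(T₂.biUnion D₂)) + (#Z₁ + #Z₂) := by
      exact_mod_cast h1
    have h3 : 3 * (m : ℝ) / (4 * C) = m / (8 * C) + m / (8 * C) + (m / (4 * C) + m / (4 * C)) := by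
      ring
    linarith
  have hCpos : (0 : ℝ) < C := by exact_mod_cast (by omega : 0 < C)
  have hlow : (1 - 1 / (C : ℝ)) * ((m + 1 : ℕ) : ℝ) ≤ #(J \ X) := by
    have h1 : (m : ℝ) ≤ #(J \ X) + #X := by
      rw [← hJc]
      exact_mod_cast tsub_le_iff_right.1 (le_card_sdiff X J)
    have h2 : 1 ≤ (m : ℝ) / (4 * C) := by
      rw [le_div_iff₀ (by positivity)]
      rw [one_mul]
      exact_mod_cast hmC
    have h3 : 3 * (m : ℝ) / (4 * C) = 3 * (m / (4 * C)) := by ring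
    have h4 : (1 - 1 / (C : ℝ)) * ((m + 1 : ℕ) : ℝ) = m + 1 - 4 * (m / (4 * C)) - 1 / C := by
      push_cast
      field_simp
      ring
    have h5 : 0 < 1 / (C : ℝ) := by positivity
    linarith
  refine hlow.trans (Nat.cast_le.2 (card_le_card fun i hi => ?_))
  simp only [hX, mem_sdiff, mem_union, mem_biUnion, not_or, not_exists, not_and] at hi
  obtain ⟨hiJ, ⟨hiT₁, hiT₂⟩, hiZ₁, hiZ₂⟩ := hi
  refine mem_filter.2 ⟨hiJ, fun v hv u hu => ?_⟩
  have hvD : i ∉ D₁ v := by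
    rcases mem_union.1 hv with hv | hv
    · intro h
      exact hiZ₁ (mem_filter.2 ⟨hiJ, π.1 v, (hmem _ _ _).1 hv, by simpa using h⟩)
    · exact hiT₁ v hv
  have huD : i ∉ D₂ u := by
    rcases mem_union.1 hu with hu | hu
    · intro h
      exact hiZ₂ (mem_filter.2 ⟨hiJ, π.2 u, (hmem _ _ _).1 hu, by simpa using h⟩)
    · exact hiT₂ u hu
  have hv1 := le_card_neighbors_of_notMem_deficientBlocks hiJ (hWc i hiJ) hvD
  have hu1 := le_card_neighbors_of_notMem_deficientBlocks hiJ (hWc i hiJ) huD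
  have hv2 : (#{b | π.2 b ∈ W i ∧ Adj v b} : ℝ) ≤ #{b ∈ bipCluster n C i π.2 ∪ T₂ | Adj v b} := by
    refine Nat.cast_le.2 (card_le_card fun b hb => ?_)
    have hb := (mem_filter.1 hb).2
    exact mem_filter.2 ⟨mem_union_left _ ((hmem _ _ _).2 hb.1), hb.2⟩
  have hu2 : (#{a | π.1 a ∈ W i ∧ flip Adj u a} : ℝ) ≤
      #{a ∈ bipCluster n C i π.1 ∪ T₁ | Adj a u} := by
    refine Nat.cast_le.2 (card_le_card fun b hb => ?_)
    have hb := (mem_filter.1 hb).2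
    exact mem_filter.2 ⟨mem_union_left _ ((hmem _ _ _).2 hb.1), hb.2⟩
  refine le_trans ?_ (add_le_add (hv1.trans hv2) (hu1.trans hu2))
  have hnpos : (0 : ℝ) < n := by exact_mod_cast v.pos
  have hd : 1 + ε ≤ (#{b' | Adj v b'} : ℝ) / n + (#{a' | flip Adj u a'} : ℝ) / n := by
    rw [← add_div, le_div_iff₀ hnpos]
    exact hdeg v u
  rw [Fintype.card_fin, Nat.cast_sub (by omega : 1 ≤ C), ← mul_add, Nat.cast_one]
  have hC1 : (0 : ℝ) ≤ (C : ℝ) - 1 := by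
    rw [sub_nonneg]; exact_mod_cast (by omega : 1 ≤ C)
  calc (1 + ε / 2) * (C : ℝ) ≤ ((C : ℝ) - 1) * (1 + 3 * ε / 4) := by linarith
    _ ≤ _ := mul_le_mul_of_nonneg_left (by linarith) hC1

open Finset in
theorem one_sub_le_permProb {N M : ℕ} (E P Q : Equiv.Perm (Fin N) × Equiv.Perm (Fin M) → Prop)
    (a b : ℝ) (h : ∀ π, ¬ P π → ¬ Q π → E π) (hP : permProb N M P ≤ a)
    (hQ : permProb N M Q ≤ b) : 1 - (a + b) ≤ permProb N M E := by
  classical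
  unfold permProb at *
  have hpos : (0 : ℝ) < #(univ : Finset (Equiv.Perm (Fin N) × Equiv.Perm (Fin M))) := by
    exact_mod_cast card_pos.2 univ_nonempty
  rw [div_le_iff₀ hpos] at hP hQ
  rw [le_div_iff₀ hpos]
  have hsub : (univ : Finset (Equiv.Perm (Fin N) × Equiv.Perm (Fin M))) ⊆
      univ.filter E ∪ (univ.filter P ∪ univ.filter Q) := by
    intro π _
    simp only [mem_union, mem_filter, mem_univ, true_and]
    by_contra! hc
    exact hc.1 (h π hc.2.1 hc.2.2)
  have hc := (card_le_card hsub).trans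
    ((card_union_le _ _).trans (Nat.add_le_add_left (card_union_le _ _) _))
  have hc' := (Nat.cast_le (α := ℝ)).2 hc
  rw [Nat.cast_add, Nat.cast_add] at hc'
  linarith

open Classical in
theorem bip_many_assignable_clusters (ε : ℝ) (hε : 0 < ε) :
    ∃ C₀ : ℕ, ∀ C : ℕ, C₀ ≤ C →
    ∃ n₀ : ℕ, ∀ n : ℕ, n₀ ≤ n →
    ∀ Adj : Fin n → Fin n → Prop,
      (∀ a b : Fin n,
        (1 + ε) * n ≤ ((Finset.univ.filter fun b' => Adj a b').card : ℝ) +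
          ((Finset.univ.filter fun a' => Adj a' b).card : ℝ)) →
      (99 : ℝ) / 100 ≤
        permProb n n (fun π =>
          ∀ T₁ T₂ : Finset (Fin n), T₁.card ≤ 1 → T₂.card ≤ 1 →
            (1 - 1 / (C : ℝ)) * (numClustersBip n C : ℝ) ≤
              (((Finset.Icc 2 (numClustersBip n C)).filter fun i =>
                ∀ v ∈ bipCluster n C i π.1 ∪ T₁, ∀ u ∈ bipCluster n C i π.2 ∪ T₂,
                  (1 + ε / 2) * (C : ℝ) ≤
                    (((bipCluster n C i π.2 ∪ T₂).filter fun b => Adj v b).card : ℝ) +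
                      (((bipCluster n C i π.1 ∪ T₁).filter fun a => Adj a u).card : ℝ)).card
                : ℝ)) := by
  set η := ε / 8 with hη
  have hη0 : 0 < η := by positivity
  by_cases hε1 : 1 < ε
  · refine ⟨0, fun C _ => ⟨1, fun n hn Adj hdeg => ?_⟩⟩
    exfalso
    have h := hdeg ⟨0, hn⟩ ⟨0, hn⟩
    have h1 : ∀ s : Finset (Fin n), (s.card : ℝ) ≤ n := fun s => by
      exact_mod_cast s.card_le_univ.trans_eq (Fintype.card_fin n)
    have hn0 : (0 : ℝ) < n := by exact_mod_cast hn
    have h2 := h.trans (add_le_add (h1 _) (h1 _))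
    nlinarith
  rw [not_lt] at hε1
  obtain ⟨C₀, hC₀⟩ := exists_forall_cluster_size ε hε (η ^ 2 / 4) (by positivity)
  refine ⟨C₀, fun C hCC₀ => ?_⟩
  obtain ⟨hC, hCε, hexp⟩ := hC₀ C hCC₀
  have hC2 : (2 : ℝ) ≤ C := by exact_mod_cast hC
  have hCpos : (0 : ℝ) < C := by linarith
  set γ : ℝ := 1 / (1600 * (C : ℝ) ^ 2) with hγ
  have hγ0 : 0 < γ := by positivity
  obtain ⟨n₀, hn₀⟩ := exists_forall_mul_exp_le (γ / (2 * C)) (C * γ) (by positivity) (6 * C ^ 2)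
  refine ⟨n₀, fun n hnn₀ Adj hdeg => ?_⟩
  obtain ⟨hn6, hnexp⟩ := hn₀ n hnn₀
  obtain ⟨m, hm⟩ : ∃ m, m = (n - ((C - 1) * C + n % ((C - 1) * C))) / (C - 1) := ⟨_, rfl⟩
  obtain ⟨hnm, hnle⟩ := numClustersBip_eq hC (by omega) hm
  have hm1 : m + 1 = numClustersBip n C := by rw [hm, numClustersBip]
  have hmC : 4 * C ≤ m := by
    have : C * (4 * C) ≤ C * m := by
      have : C * (4 * C) = 4 * C ^ 2 := by ring
      omega
    exact Nat.le_of_mul_le_mul_left this (by omega)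
  have hm0 : (0 : ℝ) < m := by exact_mod_cast (by omega : 0 < m)
  have hdisj : ((Finset.Icc 2 (m + 1) : Finset ℕ) : Set ℕ).PairwiseDisjoint
      (clusterPositions n C) := by
    intro i _ j _ hij
    rw [Function.onFun, Finset.disjoint_left]
    intro x hx hx'
    exact hij ((Finset.mem_filter.1 hx).2.symm.trans (Finset.mem_filter.1 hx').2)
  have hcard : ∀ i ∈ Finset.Icc 2 (m + 1), (clusterPositions n C i).card = C - 1 :=
    fun i hi => card_filter_clusterIndex (by omega) hnm hi
  have hJ : (Finset.Icc 2 (m + 1)).card = m := by rw [Nat.card_Icc]; omega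
  have hspread : ∀ R : Fin n → Fin n → Prop,
      permProb n n (fun π => ¬ IsWellSpread R (clusterPositions n C) (Finset.Icc 2 (m + 1))
        (C - 1) η γ (m / (4 * C)) π) ≤ 1 / 200 := by
    intro R
    have h := card_not_isWellSpread_le R (clusterPositions n C) (Finset.Icc 2 (m + 1)) hdisj
      (C - 1) hcard η γ (m / (4 * C)) hη0.le (by linarith) hγ0.le (by positivity)
    have hN : ((Finset.univ : Finset (Equiv.Perm (Fin n) × Equiv.Perm (Fin n))).card : ℝ) =
        (Fintype.card (Equiv.Perm (Fin n)) : ℝ) ^ 2 := by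
      rw [Finset.card_univ, Fintype.card_prod, Nat.cast_mul, sq]
    have hNpos : (0 : ℝ) < Fintype.card (Equiv.Perm (Fin n)) := by
      exact_mod_cast Fintype.card_pos
    unfold permProb
    rw [hN, div_le_iff₀ (by positivity)]
    refine (le_of_eq (by congr!)).trans (h.trans ?_)
    gcongr
    rw [hJ, Fintype.card_fin]
    have h1 : (n : ℝ) * Real.exp (m * (2 * Real.exp (-(η ^ 2 / 4)) ^ (C - 1) - γ)) ≤ 1 / 400 := by
      refine le_trans ?_ hnexp
      gcongr
      have h2 : 2 * Real.exp (-(η ^ 2 / 4)) ^ (C - 1) - γ ≤ -(γ / 2) := by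
        have : 1 / (6400 * (C : ℝ) ^ 2) = γ / 4 := by rw [hγ]; ring
        linarith
      have h3 : (n : ℝ) ≤ C * m + 2 * C ^ 2 := by exact_mod_cast hnle
      calc (m : ℝ) * (2 * Real.exp (-(η ^ 2 / 4)) ^ (C - 1) - γ) ≤ m * (-(γ / 2)) := by gcongr
        _ = C * γ - γ / (2 * C) * (C * m + 2 * C ^ 2) := by field_simp; ring
        _ ≤ _ := by gcongr
    have h2 : ((C - 1 : ℕ) : ℝ) * (γ * m) / (m / (4 * C)) ≤ 1 / 400 := by
      have h3 : ((C - 1 : ℕ) : ℝ) ≤ C := by exact_mod_cast Nat.sub_le C 1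
      calc ((C - 1 : ℕ) : ℝ) * (γ * m) / (m / (4 * C)) ≤ C * (γ * m) / (m / (4 * C)) := by gcongr
        _ = 1 / 400 := by rw [hγ]; field_simp; norm_num
    linarith
  have hswap : permProb n n (fun π => ¬ IsWellSpread (flip Adj) (clusterPositions n C)
      (Finset.Icc 2 (m + 1)) (C - 1) η γ (m / (4 * C)) π.swap) ≤ 1 / 200 := by
    refine le_of_eq_of_le ?_ (hspread (flip Adj))
    unfold permProb
    congr 2
    exact Finset.card_equiv (Equiv.prodComm _ _) fun π => by simp
  refine le_trans (by norm_num) (one_sub_le_permProb _ _ _ _ _ (fun π h₁ h₂ T₁ T₂ hT₁ hT₂ => ?_)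
    (hspread Adj) hswap)
  refine le_card_filter_of_isWellSpread hC hCε hm1 hnm hmC ?_ Adj hdeg π (not_not.1 h₁)
    (not_not.1 h₂) T₁ T₂ hT₁ hT₂
  rw [hγ]
  gcongr 1 / ?_
  nlinarith
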